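/- arXiv:2112.14900 — 5 statements merged into one kernel-verified Lean document; each statement's English description precedes it below -/
import Mathlib

section
/- Lemma 1 (layer-level simulation of a standard GNN by a special case of MGNN): Suppose additionally that ω : (V → ℝ^d) → ℝ^d sends the identically-zero family to the zero vector and that σ : ℝ → ℝ satisfies σ(0) = 0 (applied entrywise to vectors). Then there exist a weight matrix W_m ∈ ℝ^{d×d_0} and coefficients α : {1,…,13} × V × V → ℝ such that for every node v, the MGNN layer output equals the standard GNN layer output padded with twelve zero blocks: for every k ∈ {1,…,12} the k-th block σ(ω(i ↦ α_{k,vi}·(A_k)_{vi}·(W_m h_i))) is the zero vector of ℝ^d, and the 13th block σ(ω(i ↦ α_{13,vi}·(A_13)_{vi}·(W_m h_i))) equals σ(ω(i ↦ (A)_{vi}·(W_s h_i))). -/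
/-- Lemma 1 of "Motif Graph Neural Network" (layer-level simulation of a
standard GNN by a special case of MGNN): if the aggregation `ω` sends the
zero family to zero and the entrywise activation satisfies `σ 0 = 0`, then,
under the support assumption on `A₁₃` (here `Ak 12`), there exist a weight
matrix `Wm` and coefficients `α` so that at every node the MGNN layer output
is the standard GNN layer output padded with twelve zero blocks. -/
theorem mgnn_simulates_standard_gnn_layer
    {V : Type*} [Fintype V] {d d₀ : ℕ}
    (A : V → V → ℝ) (Ak : Fin 13 → V → V → ℝ)
    (h : V → Fin d₀ → ℝ) (Ws : Matrix (Fin d) (Fin d₀) ℝ)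
    (ω : (V → Fin d → ℝ) → Fin d → ℝ) (σ : ℝ → ℝ)
    (hsupp : ∀ v i : V, A v i ≠ 0 → Ak 12 v i ≠ 0)
    (hω : ω (fun _ => (0 : Fin d → ℝ)) = 0) (hσ : σ 0 = 0) :
    ∃ (Wm : Matrix (Fin d) (Fin d₀) ℝ) (α : Fin 13 → V → V → ℝ),
      ∀ v : V,
        (∀ k : Fin 13, (k : ℕ) < 12 →
          (fun j : Fin d =>
            σ (ω (fun i : V => α k v i • Ak k v i • Wm.mulVec (h i)) j))
            = (0 : Fin d → ℝ)) ∧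
        (fun j : Fin d =>
          σ (ω (fun i : V => α 12 v i • Ak 12 v i • Wm.mulVec (h i)) j))
          = fun j : Fin d =>
              σ (ω (fun i : V => A v i • Ws.mulVec (h i)) j) := by
  refine ⟨Ws, fun k v i => if (k : ℕ) < 12 then 0 else A v i / Ak 12 v i, fun v => ⟨?_, ?_⟩⟩
  · intro k hk
    funext j
    simp only [if_pos hk, zero_smul, hω, Pi.zero_apply, hσ]
  · have hcoeff : ∀ i, A v i / Ak 12 v i * Ak 12 v i = A v i := fun i =>
      div_mul_cancel_of_imp fun hk => by_contra fun hA => hsupp v i hA hk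
    have hlast : ¬ ((12 : Fin 13) : ℕ) < 12 := by decide
    simp only [if_neg hlast, smul_smul, hcoeff]
end

section
/- Correctness of the non-enumeration construction for the out-star motif M_8: Let G be a digraph on a finite vertex set V and let (v,u) be an edge of G. Then the number of instances of M_8 that contain the edge (v,u) equals outdeg(v) − 1; that is, the motif-based adjacency entry satisfies (A_{M_8})_{v,u} = outdeg(v) − 1 (the paper's formula (A_8)_{v,u_out} = d_out − 1). -/
/-- The vertex set of the edge-induced subgraph determined by an edge set
`E'`: all endpoints of edges in `E'`. -/
def motifVerts {V : Type*} [DecidableEq V] (E' : Finset (V × V)) : Finset V :=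
  E'.image Prod.fst ∪ E'.image Prod.snd

/-- `E'` is an instance of the 3-node motif with edge relation `Rm` in the
digraph `G`: every pair in `E'` is an edge of `G`, and the edge-induced
subgraph on the endpoints of `E'` is isomorphic to the motif as a digraph. -/
def IsMotifInstance {V : Type*} [DecidableEq V] (G : V → V → Prop)
    (Rm : Fin 3 → Fin 3 → Prop) (E' : Finset (V × V)) : Prop :=
  (∀ p ∈ E', G p.1 p.2) ∧
  ∃ e : {x // x ∈ motifVerts E'} ≃ Fin 3,
    ∀ a b : {x // x ∈ motifVerts E'}, ((a : V), (b : V)) ∈ E' ↔ Rm (e a) (e b)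

/-- Out-degree of a vertex in a digraph. -/
def outdeg {V : Type*} [Fintype V] (G : V → V → Prop) [DecidableRel G]
    (v : V) : ℕ :=
  (Finset.univ.filter fun w => G v w).card

/-- The out-star motif `M₈`: vertices `{0,1,2}` with edges `(0,1)` and
`(0,2)`. -/
def M8 : Fin 3 → Fin 3 → Prop := fun a b =>
  (a = 0 ∧ b = 1) ∨ (a = 0 ∧ b = 2)

theorem isMotifInstance_M8_iff {V : Type*} [DecidableEq V] (G : V → V → Prop)
    (E' : Finset (V × V)) :
    IsMotifInstance G M8 E' ↔
      ∃ c x y : V, c ≠ x ∧ c ≠ y ∧ x ≠ y ∧ G c x ∧ G c y ∧ E' = {(c, x), (c, y)} := by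
  constructor
  · rintro ⟨hG, e, he⟩
    have hne : ∀ i j : Fin 3, i ≠ j → (e.symm i : V) ≠ e.symm j := fun i j hij h =>
      hij (e.symm.injective (Subtype.ext h))
    have hmem : ∀ i j : Fin 3, ((e.symm i : V), (e.symm j : V)) ∈ E' ↔ M8 i j := fun i j => by
      simpa using he (e.symm i) (e.symm j)
    have h1 := (hmem 0 1).2 (by simp [M8])
    have h2 := (hmem 0 2).2 (by simp [M8])
    refine ⟨e.symm 0, e.symm 1, e.symm 2, hne _ _ (by decide), hne _ _ (by decide),
      hne _ _ (by decide), hG _ h1, hG _ h2, ?_⟩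
    ext ⟨a, b⟩
    simp only [Finset.mem_insert, Finset.mem_singleton]
    constructor
    · intro hab
      have ha : a ∈ motifVerts E' :=
        Finset.mem_union_left _ (Finset.mem_image_of_mem Prod.fst hab)
      have hb : b ∈ motifVerts E' :=
        Finset.mem_union_right _ (Finset.mem_image_of_mem Prod.snd hab)
      rcases (he ⟨a, ha⟩ ⟨b, hb⟩).1 hab with ⟨h, h'⟩ | ⟨h, h'⟩
      · left
        simp [← h, ← h']
      · right
        simp [← h, ← h']
    · rintro (h | h) <;> rw [h] <;> assumption
  · rintro ⟨c, x, y, hcx, hcy, hxy, hGx, hGy, rfl⟩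
    refine ⟨by simp [hGx, hGy], ?_⟩
    have hverts : ∀ a, a ∈ motifVerts {(c, x), (c, y)} ↔ a = c ∨ a = x ∨ a = y := by
      intro a
      simp [motifVerts, or_left_comm]
    let f : Fin 3 → {a // a ∈ motifVerts {(c, x), (c, y)}} :=
      ![⟨c, by simp [hverts]⟩, ⟨x, by simp [hverts]⟩, ⟨y, by simp [hverts]⟩]
    have hf : Function.Bijective f := by
      constructor
      · intro i j hij
        fin_cases i <;> fin_cases j <;>
          simp [f, hcx, hcy, hxy, hcx.symm, hcy.symm, hxy.symm] at hij ⊢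
      · rintro ⟨a, ha⟩
        rcases (hverts a).1 ha with rfl | rfl | rfl
        exacts [⟨0, rfl⟩, ⟨1, rfl⟩, ⟨2, rfl⟩]
    refine ⟨(Equiv.ofBijective f hf).symm, fun a b => ?_⟩
    obtain ⟨i, rfl⟩ := (Equiv.ofBijective f hf).surjective a
    obtain ⟨j, rfl⟩ := (Equiv.ofBijective f hf).surjective b
    rw [Equiv.symm_apply_apply, Equiv.symm_apply_apply, Equiv.ofBijective_apply,
      Equiv.ofBijective_apply]
    fin_cases i <;> fin_cases j <;>
      simp [f, M8, hcx, hcy, hxy, hcx.symm, hcy.symm, hxy.symm]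

/-- Correctness of the non-enumeration construction for the out-star motif
`M₈` ("Motif Graph Neural Network", Section IV-B): for an edge `(v,u)` of a
loopless digraph `G`, the number of instances of `M₈` containing `(v,u)`
equals `outdeg v - 1`. -/
theorem motif_adjacency_M8 {V : Type*} [Fintype V] [DecidableEq V]
    (G : V → V → Prop) [DecidableRel G] (hirr : Irreflexive G)
    (v u : V) (hvu : G v u) :
    Set.ncard {E' : Finset (V × V) |
        IsMotifInstance G M8 E' ∧ (v, u) ∈ E'}
      = outdeg G v - 1 := by
  have hset : {E' : Finset (V × V) | IsMotifInstance G M8 E' ∧ (v, u) ∈ E'} =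
      (fun w => ({(v, u), (v, w)} : Finset (V × V))) ''
        (((Finset.univ.filter fun w => G v w).erase u : Finset V) : Set V) := by
    have hne : ∀ w, G v w → v ≠ w := by
      rintro w hw rfl
      exact hirr _ hw
    ext E'
    simp only [Set.mem_ofPred_eq, isMotifInstance_M8_iff, Set.mem_image, Finset.mem_coe,
      Finset.mem_erase, Finset.mem_filter, Finset.mem_univ, true_and]
    constructor
    · rintro ⟨⟨c, x, y, -, -, hxy, hGx, hGy, rfl⟩, hmem⟩
      simp only [Finset.mem_insert, Finset.mem_singleton, Prod.mk.injEq] at hmem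
      rcases hmem with ⟨rfl, rfl⟩ | ⟨rfl, rfl⟩
      · exact ⟨y, ⟨hxy.symm, hGy⟩, rfl⟩
      · exact ⟨x, ⟨hxy, hGx⟩, Finset.pair_comm _ _⟩
    · rintro ⟨w, ⟨hwu, hGw⟩, rfl⟩
      exact ⟨⟨v, u, w, hne u hvu, hne w hGw, hwu.symm, hvu, hGw, rfl⟩, by simp⟩
  rw [hset, Set.InjOn.ncard_image, Set.ncard_coe_finset,
    Finset.card_erase_of_mem (by simpa using hvu), outdeg]
  intro w hw w' _ h
  have hmem : (v, w) ∈ ({(v, u), (v, w')} : Finset (V × V)) := by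
    rw [← show ({(v, u), (v, w)} : Finset (V × V)) = {(v, u), (v, w')} from h]
    simp
  simp only [Finset.coe_erase, Set.mem_sdiff, Set.mem_singleton_iff] at hw
  simpa [hw.2] using hmem
end

section
/- Correctness of the non-enumeration construction for the in-star motif M_10: Let G be a digraph on a finite vertex set V and let (u,v) be an edge of G. Then the number of instances of M_10 that contain the edge (u,v) equals indeg(v) − 1; that is, (A_{M_10})_{u,v} = indeg(v) − 1 (the paper's formula (A_10)_{v,u_in} = d_in − 1). -/
/-- In-degree of a vertex in a digraph. -/
def indeg {V : Type*} [Fintype V] (G : V → V → Prop) [DecidableRel G]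
    (v : V) : ℕ :=
  (Finset.univ.filter fun w => G w v).card

/-- The in-star motif `M₁₀`: vertices `{0,1,2}` with edges `(1,0)` and
`(2,0)`. -/
def M10 : Fin 3 → Fin 3 → Prop := fun a b =>
  (a = 1 ∧ b = 0) ∨ (a = 2 ∧ b = 0)

/-- The instances of `M₁₀` are exactly the pairs of edges with distinct sources and a
common target. -/
theorem isMotifInstance_M10_iff {V : Type*} [DecidableEq V] {G : V → V → Prop}
    (hirr : ∀ x, ¬ G x x) (E' : Finset (V × V)) :
    IsMotifInstance G M10 E' ↔
      ∃ a b c : V, b ≠ c ∧ G b a ∧ G c a ∧ E' = {(b, a), (c, a)} := by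
  constructor
  · rintro ⟨hG, e, he⟩
    have key : ∀ i j : Fin 3,
        ((e.symm i : V), (e.symm j : V)) ∈ E' ↔ M10 i j := fun i j => by
      simpa using he (e.symm i) (e.symm j)
    have h10 := (key 1 0).2 (Or.inl ⟨rfl, rfl⟩)
    have h20 := (key 2 0).2 (Or.inr ⟨rfl, rfl⟩)
    refine ⟨e.symm 0, e.symm 1, e.symm 2, ?_, hG _ h10, hG _ h20, ?_⟩
    · intro h
      have := e.symm.injective (Subtype.ext h)
      simp at this
    · ext ⟨x, y⟩
      simp only [Finset.mem_insert, Finset.mem_singleton]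
      constructor
      · intro hxy
        have hx : x ∈ motifVerts E' :=
          Finset.mem_union_left _ (Finset.mem_image_of_mem Prod.fst hxy)
        have hy : y ∈ motifVerts E' :=
          Finset.mem_union_right _ (Finset.mem_image_of_mem Prod.snd hxy)
        rcases (he ⟨x, hx⟩ ⟨y, hy⟩).1 hxy with ⟨h1, h0⟩ | ⟨h2, h0⟩
        · left
          simp [← h1, ← h0]
        · right
          simp [← h2, ← h0]
      · rintro (h | h)
        · rwa [h]
        · rwa [h]
  · rintro ⟨a, b, c, hbc, hb, hc, rfl⟩
    have hba : b ≠ a := fun h => hirr a (h ▸ hb)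
    have hca : c ≠ a := fun h => hirr a (h ▸ hc)
    refine ⟨by simp [hb, hc], ?_⟩
    have hmem : ∀ i : Fin 3, ![a, b, c] i ∈ motifVerts {(b, a), (c, a)} := by
      intro i
      fin_cases i <;> simp [motifVerts]
    let f : Fin 3 → {x // x ∈ motifVerts {(b, a), (c, a)}} := fun i => ⟨![a, b, c] i, hmem i⟩
    have hf : Function.Bijective f := by
      constructor
      · intro i j hij
        have hij' : ![a, b, c] i = ![a, b, c] j := congrArg Subtype.val hij
        fin_cases i <;> fin_cases j <;>
          simp_all [hba.symm, hca.symm, hbc.symm]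
      · rintro ⟨x, hx⟩
        have hx' : x = b ∨ x = c ∨ x = a := by
          simp [motifVerts] at hx
          tauto
        rcases hx' with rfl | rfl | rfl
        · exact ⟨1, rfl⟩
        · exact ⟨2, rfl⟩
        · exact ⟨0, rfl⟩
    refine ⟨(Equiv.ofBijective f hf).symm, fun x y => ?_⟩
    obtain ⟨i, rfl⟩ := (Equiv.ofBijective f hf).surjective x
    obtain ⟨j, rfl⟩ := (Equiv.ofBijective f hf).surjective y
    rw [Equiv.symm_apply_apply, Equiv.symm_apply_apply]
    fin_cases i <;> fin_cases j <;>
      simp [f, M10, hba, hca, hbc, hba.symm, hca.symm, hbc.symm]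

/-- Correctness of the non-enumeration construction for the in-star motif
`M₁₀` ("Motif Graph Neural Network", Section IV-B): for an edge `(u,v)` of a
loopless digraph `G`, the number of instances of `M₁₀` containing `(u,v)`
equals `indeg v - 1`. -/
theorem motif_adjacency_M10 {V : Type*} [Fintype V] [DecidableEq V]
    (G : V → V → Prop) [DecidableRel G] (hirr : Irreflexive G)
    (u v : V) (huv : G u v) :
    Set.ncard {E' : Finset (V × V) |
        IsMotifInstance G M10 E' ∧ (u, v) ∈ E'}
      = indeg G v - 1 := by
  have hset : {E' : Finset (V × V) | IsMotifInstance G M10 E' ∧ (u, v) ∈ E'} =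
      (fun w => ({(u, v), (w, v)} : Finset (V × V))) ''
        ((Finset.univ.filter fun w => G w v).erase u : Finset V) := by
    ext E'
    simp only [Set.mem_ofPred_eq, isMotifInstance_M10_iff hirr, Set.mem_image, Finset.mem_coe,
      Finset.mem_erase, Finset.mem_filter, Finset.mem_univ, true_and]
    constructor
    · rintro ⟨⟨a, b, c, hbc, hb, hc, rfl⟩, huvE⟩
      simp only [Finset.mem_insert, Finset.mem_singleton, Prod.mk.injEq] at huvE
      rcases huvE with ⟨rfl, rfl⟩ | ⟨rfl, rfl⟩
      · exact ⟨c, ⟨hbc.symm, hc⟩, rfl⟩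
      · exact ⟨b, ⟨hbc, hb⟩, Finset.pair_comm _ _⟩
    · rintro ⟨w, ⟨hwu, hw⟩, rfl⟩
      exact ⟨⟨v, u, w, hwu.symm, huv, hw, rfl⟩, by simp⟩
  have hinj : Set.InjOn (fun w => ({(u, v), (w, v)} : Finset (V × V)))
      ((Finset.univ.filter fun w => G w v).erase u : Finset V) := by
    intro w hw w' _ h
    have hwu : w ≠ u := (Finset.mem_erase.1 (Finset.mem_coe.1 hw)).1
    have hmem : (w, v) ∈ ({(u, v), (w', v)} : Finset (V × V)) := by
      rw [← show _ = ({(u, v), (w', v)} : Finset (V × V)) from h]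
      simp
    simpa [hwu] using hmem
  rw [hset, hinj.ncard_image, Set.ncard_coe_finset,
    Finset.card_erase_of_mem (by simpa using huv), indeg]
end

section
/- Correctness of the non-enumeration construction for the directed-path motif M_9: Let G be a digraph on a finite vertex set V and let (u,v) be an edge of G with ¬G v u (so u is a strictly incoming neighbor of v). Then the number of two-element edge sets E' of G containing the edge (u,v) that are instances of M_9 with v as the middle vertex — i.e., sets of the form {(u,v),(v,b)} with G v b and b ∉ {u,v} — equals outdeg(v) (the paper's formula (A_9)_{v,u_in} = d_out). -/
/-- Correctness of the non-enumeration construction for the directed-path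
motif `M₉` ("Motif Graph Neural Network", Section IV-B): let `(u,v)` be an
edge of a loopless digraph `G` with `¬ G v u` (so `u` is a strictly incoming
neighbor of `v`).  The number of two-element edge sets containing `(u,v)`
that form an instance of `M₉` with `v` as middle vertex — i.e., sets of the
form `{(u,v), (v,b)}` with `G v b` and `b ∉ {u, v}` — equals `outdeg v`. -/
theorem motif_adjacency_M9 {V : Type*} [Fintype V] [DecidableEq V]
    (G : V → V → Prop) [DecidableRel G] (hirr : Irreflexive G)
    (u v : V) (huv : G u v) (hvu : ¬ G v u) :
    Set.ncard {E' : Finset (V × V) |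
        ∃ b : V, b ≠ u ∧ b ≠ v ∧ G v b ∧
          E' = {(u, v), (v, b)} ∧ (u, v) ∈ E'}
      = outdeg G v := by
  have hset : {E' : Finset (V × V) | ∃ b : V, b ≠ u ∧ b ≠ v ∧ G v b ∧
      E' = {(u, v), (v, b)} ∧ (u, v) ∈ E'} =
      (fun b => ({(u, v), (v, b)} : Finset (V × V))) ''
        (Finset.univ.filter fun w => G v w : Finset V) := by
    ext E
    simp only [Set.mem_setOf_eq, Set.mem_image, Finset.coe_filter, Finset.mem_univ, true_and]
    constructor
    · rintro ⟨b, -, -, hb, rfl, -⟩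
      exact ⟨b, hb, rfl⟩
    · rintro ⟨b, hb, rfl⟩
      exact ⟨b, fun h => hvu (h ▸ hb), fun h => hirr v (by rwa [h] at hb), hb, rfl, by simp⟩
  have huv_ne : u ≠ v := fun h => hirr v (by rwa [h] at huv)
  have hinj : Function.Injective fun b => ({(u, v), (v, b)} : Finset (V × V)) := by
    intro b c hbc
    have hmem : (v, b) ∈ ({(u, v), (v, c)} : Finset (V × V)) := by
      rw [← show ({(u, v), (v, b)} : Finset (V × V)) = {(u, v), (v, c)} from hbc]
      simp
    simpa [huv_ne.symm] using hmem
  rw [hset, Set.ncard_image_of_injective _ hinj, Set.ncard_coe_finset, outdeg]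
end

section
/- Correctness of the non-enumeration construction for the bidirectional-star motif M_13: Let G be a digraph on a finite vertex set V and let v, u be vertices with both G v u and G u v (u is a bidirectional neighbor of v). Then the number of instances of M_13 with v as the center vertex that contain the edge (v,u) — i.e., edge sets of the form {(v,u),(u,v),(v,b),(b,v)} with b ∉ {u,v}, G v b and G b v — equals bideg(v) − 1 (the paper's formula (A_13)_{v,u_bi} = d_bi − 1). -/
/-- Bidirectional degree of a vertex in a digraph: the number of vertices
`w` with both `G v w` and `G w v`. -/
def bideg {V : Type*} [Fintype V] (G : V → V → Prop) [DecidableRel G]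
    (v : V) : ℕ :=
  (Finset.univ.filter fun w => G v w ∧ G w v).card

/-- Correctness of the non-enumeration construction for the
bidirectional-star motif `M₁₃` ("Motif Graph Neural Network", Section IV-B):
let `u` be a bidirectional neighbor of `v` in a loopless digraph `G` (both
`G v u` and `G u v`).  The number of instances of `M₁₃` with center `v`
containing the edge `(v,u)` — i.e., edge sets of the form
`{(v,u), (u,v), (v,b), (b,v)}` with `b ∉ {u, v}`, `G v b` and `G b v` —
equals `bideg v - 1`. -/
theorem motif_adjacency_M13 {V : Type*} [Fintype V] [DecidableEq V]
    (G : V → V → Prop) [DecidableRel G] (hirr : Irreflexive G)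
    (v u : V) (hvu : G v u) (huv : G u v) :
    Set.ncard {E' : Finset (V × V) |
        ∃ b : V, b ≠ u ∧ b ≠ v ∧ G v b ∧ G b v ∧
          E' = {(v, u), (u, v), (v, b), (b, v)} ∧ (v, u) ∈ E'}
      = bideg G v - 1 := by
  have hset : {E' : Finset (V × V) |
        ∃ b : V, b ≠ u ∧ b ≠ v ∧ G v b ∧ G b v ∧
          E' = {(v, u), (u, v), (v, b), (b, v)} ∧ (v, u) ∈ E'} =
      Set.image (fun b => ({(v, u), (u, v), (v, b), (b, v)} : Finset (V × V)))
        (((Finset.univ.filter fun w => G v w ∧ G w v).erase u : Finset V) : Set V) := by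
    ext E'
    constructor
    · rintro ⟨b, hbu, -, hvb, hbv, rfl, -⟩
      exact ⟨b, by simp [hbu, hvb, hbv], rfl⟩
    · rintro ⟨b, hb, rfl⟩
      obtain ⟨⟨hvb, hbv⟩, hbu⟩ : (G v b ∧ G b v) ∧ b ≠ u := by simpa using hb
      exact ⟨b, hbu, fun h => hirr v (h ▸ hvb), hvb, hbv, rfl, by simp⟩
  rw [hset, Set.InjOn.ncard_image, Set.ncard_coe_finset,
    Finset.card_erase_of_mem (by simp [hvu, huv]), bideg]
  intro b hb c _ hbc
  obtain ⟨⟨hvb, -⟩, hbu⟩ : (G v b ∧ G b v) ∧ b ≠ u := by simpa using hb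
  have hbv : b ≠ v := fun h => hirr v (h ▸ hvb)
  have hmem : (v, b) ∈ ({(v, u), (u, v), (v, c), (c, v)} : Finset (V × V)) := by
    rw [← show _ = ({(v, u), (u, v), (v, c), (c, v)} : Finset (V × V)) from hbc]
    simp
  simpa [hbu, hbv] using hmem
end
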